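/- Let p be a prime, f : Z_p → ℂ with |f̂(m)| constant over all m ∈ Z_p, and h : Z_p → ℂ with |h(x)| = c for all x ∈ Z_p and some constant c > 0. Define g : Z_p² → ℂ by g(x₁, x₂) = f(x₁)·h(x₂), and suppose c is chosen so that ‖g‖₂ = 1. Let A = {(a, 0) : a ∈ Z_p} and B = {(0, b) : b ∈ Z_p}. Then G(g, A, B) is an orthonormal basis of L²(Z_p²). -/

import Mathlib

open Finset

/-- The fixed character `χ(t) = e^{2πi t/p}` of `ℤ/p`. -/
noncomputable def chi (p : ℕ) (t : ZMod p) : ℂ :=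
  Complex.exp (2 * Real.pi * Complex.I * (t.val : ℂ) / (p : ℂ))

/-- The dot product on `ℤ_p^d`. -/
def dotp {p d : ℕ} (x y : Fin d → ZMod p) : ZMod p := ∑ i, x i * y i

/-- The Gabor (time-frequency shifted) function `x ↦ g(x-a) χ(x·b)`. -/
noncomputable def gabor {p d : ℕ} (g : (Fin d → ZMod p) → ℂ) (a b : Fin d → ZMod p) :
    (Fin d → ZMod p) → ℂ :=
  fun x => g (x - a) * chi p (dotp x b)

/-- The inner product of `L²` with counting measure on a finite type. -/
noncomputable def innerC {V : Type*} [Fintype V] (f g : V → ℂ) : ℂ :=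
  ∑ x, f x * (starRingEnd ℂ) (g x)

/-- `𝒢(g, A, B)` is an orthonormal basis of `L²(ℤ_p^d)`: the family is orthonormal and
every function is a linear combination of its members. -/
def IsGaborONB {p d : ℕ} [NeZero p] (g : (Fin d → ZMod p) → ℂ)
    (A B : Finset (Fin d → ZMod p)) : Prop :=
  (∀ a ∈ A, ∀ b ∈ B, ∀ a' ∈ A, ∀ b' ∈ B,
    innerC (gabor g a b) (gabor g a' b') = if a = a' ∧ b = b' then 1 else 0)
  ∧ (∀ f : (Fin d → ZMod p) → ℂ, ∃ c : (Fin d → ZMod p) → (Fin d → ZMod p) → ℂ,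
      f = fun x => ∑ a ∈ A, ∑ b ∈ B, c a b * gabor g a b x)

/-- `(E, B)` is a spectral pair: the characters indexed by `B` are pairwise orthogonal in
`L²(E)` and span it. -/
def IsSpectralPair {p d : ℕ} [NeZero p] (E B : Finset (Fin d → ZMod p)) : Prop :=
  (∀ b ∈ B, ∀ b' ∈ B, b ≠ b' → ∑ x ∈ E, chi p (dotp x (b - b')) = 0)
  ∧ (∀ f : (Fin d → ZMod p) → ℂ, ∃ c : (Fin d → ZMod p) → ℂ,
      ∀ x ∈ E, f x = ∑ b ∈ B, c b * chi p (dotp x b))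

/-- `(E, A)` is a tiling pair: `Σ_{a∈A} 1_E(x-a) = 1` for every `x`. -/
def IsTilingPair {p d : ℕ} [NeZero p] (E A : Finset (Fin d → ZMod p)) : Prop :=
  ∀ x : Fin d → ZMod p, (∑ a ∈ A, if x - a ∈ E then (1 : ℕ) else 0) = 1

/-- The Fourier transform `ĝ(m) = p^{-d} Σ_x χ(-x·m) g(x)` on `ℤ_p^d`. -/
noncomputable def ft {p d : ℕ} [NeZero p] (g : (Fin d → ZMod p) → ℂ)
    (m : Fin d → ZMod p) : ℂ :=
  ((p : ℂ) ^ d)⁻¹ * ∑ x, chi p (-(dotp x m)) * g x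

/-- The Fourier transform on `ℤ_p` (one-dimensional case). -/
noncomputable def ft1 {p : ℕ} [NeZero p] (f : ZMod p → ℂ) (m : ZMod p) : ℂ :=
  (p : ℂ)⁻¹ * ∑ x, chi p (-(x * m)) * f x

open scoped ComplexConjugate

theorem chi_eq_stdAddChar (p : ℕ) [NeZero p] (t : ZMod p) : chi p t = ZMod.stdAddChar t := by
  rw [ZMod.stdAddChar_apply, ZMod.toCircle_apply, chi]

/-- A family of Gabor functions that is orthonormal and has `p ^ d` members spans `L²`. -/
theorem isGaborONB_of_orthonormal {p d : ℕ} [NeZero p] (g : (Fin d → ZMod p) → ℂ)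
    (A B : Finset (Fin d → ZMod p)) (hcard : #A * #B = p ^ d)
    (horth : ∀ a ∈ A, ∀ b ∈ B, ∀ a' ∈ A, ∀ b' ∈ B,
      innerC (gabor g a b) (gabor g a' b') = if a = a' ∧ b = b' then 1 else 0) :
    IsGaborONB g A B := by
  refine ⟨horth, fun f => ⟨fun a b => innerC f (gabor g a b), ?_⟩⟩
  let M : Matrix (A × B) (Fin d → ZMod p) ℂ := fun i x => gabor g i.1 i.2 x
  have hM : M * M.conjTranspose = 1 := by
    ext i j
    rw [Matrix.mul_apply, Matrix.one_apply]
    refine (horth i.1 i.1.2 i.2 i.2.2 j.1 j.1.2 j.2 j.2.2).trans ?_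
    simp only [Prod.ext_iff, Subtype.ext_iff]
  have hM' : M.conjTranspose * M = 1 :=
    (Matrix.mul_eq_one_comm_of_card_eq _ _ _ (by simp [hcard])).1 hM
  funext x
  calc f x = ∑ y, f y * (M.conjTranspose * M) y x := by simp [hM', Matrix.one_apply]
    _ = ∑ i : A × B, innerC f (gabor g i.1 i.2) * gabor g i.1 i.2 x := by
      simp only [Matrix.mul_apply, mul_sum, innerC, sum_mul]
      rw [sum_comm]
      refine sum_congr rfl fun i _ => sum_congr rfl fun y _ => ?_
      rw [Matrix.conjTranspose_apply, mul_assoc]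
      rfl
    _ = _ := by
      rw [Fintype.sum_prod_type, ← sum_coe_sort A]
      exact sum_congr rfl fun a _ =>
        sum_coe_sort B fun b => innerC f (gabor g a b) * gabor g a b x

/-- The autocorrelation of `f` is, up to the factor `p`, the inverse Fourier transform of `|f̂|²`. -/
theorem sum_normSq_ft1_mul_stdAddChar {p : ℕ} [NeZero p] (f : ZMod p → ℂ) (t : ZMod p) :
    ∑ m, (‖ft1 f m‖ : ℂ) ^ 2 * ZMod.stdAddChar (m * t) =
      (p : ℂ)⁻¹ * ∑ x, f (x + t) * conj (f x) := by
  have hp : (p : ℂ) ≠ 0 := NeZero.ne _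
  calc ∑ m, (‖ft1 f m‖ : ℂ) ^ 2 * ZMod.stdAddChar (m * t)
      = ∑ m, ∑ x, ∑ y, (p : ℂ)⁻¹ ^ 2 * (f y * conj (f x)) *
          ZMod.stdAddChar (m * (x + t - y)) := by
        refine sum_congr rfl fun m _ => ?_
        rw [← Complex.mul_conj', ft1, map_mul, map_sum, mul_mul_mul_comm, sum_mul_sum, sum_comm,
          mul_sum, sum_mul]
        refine sum_congr rfl fun x _ => ?_
        rw [mul_sum, sum_mul]
        refine sum_congr rfl fun y _ => ?_
        have hchar : (ZMod.stdAddChar (m * (x + t - y)) : ℂ) = ZMod.stdAddChar (-(y * m)) *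
            ZMod.stdAddChar (x * m) * ZMod.stdAddChar (m * t) := by
          rw [← AddChar.map_add_eq_mul, ← AddChar.map_add_eq_mul]
          congr 1
          ring
        rw [hchar, chi_eq_stdAddChar, chi_eq_stdAddChar, map_mul, ← AddChar.map_neg_eq_conj,
          neg_neg, map_inv₀, Complex.conj_natCast]
        ring
    _ = ∑ x, ∑ y, (p : ℂ)⁻¹ ^ 2 * (f y * conj (f x)) *
          ∑ m, ZMod.stdAddChar (m * (x + t - y)) := by
        rw [sum_comm]
        refine sum_congr rfl fun x _ => ?_
        rw [sum_comm]
        simp only [mul_sum]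
    _ = _ := by
        rw [mul_sum]
        refine sum_congr rfl fun x _ => ?_
        rw [sum_eq_single (x + t)]
        · rw [AddChar.sum_mulShift _ (ZMod.isPrimitive_stdAddChar p), sub_self, if_pos rfl,
            ZMod.card]
          field_simp
        · intro y _ hy
          rw [AddChar.sum_mulShift _ (ZMod.isPrimitive_stdAddChar p),
            if_neg (sub_ne_zero.2 hy.symm), Nat.cast_zero, mul_zero]
        · simp

theorem sum_mul_conj_shift_eq_zero {p : ℕ} [NeZero p] {f : ZMod p → ℂ} {C : ℝ}
    (hf : ∀ m, ‖ft1 f m‖ = C) {t : ZMod p} (ht : t ≠ 0) :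
    ∑ x, f (x + t) * conj (f x) = 0 := by
  have key := sum_normSq_ft1_mul_stdAddChar f t
  simp only [hf, ← mul_sum] at key
  rw [AddChar.sum_mulShift _ (ZMod.isPrimitive_stdAddChar p), if_neg ht, Nat.cast_zero,
    mul_zero] at key
  exact (mul_eq_zero.1 key.symm).resolve_left (inv_ne_zero (NeZero.ne _))

theorem sum_fin_two_mul {p : ℕ} [NeZero p] (u v : ZMod p → ℂ) :
    ∑ x : Fin 2 → ZMod p, u (x 0) * v (x 1) = (∑ x, u x) * ∑ y, v y := by
  rw [sum_mul_sum, ← Fintype.sum_prod_type', ← (finTwoArrowEquiv (ZMod p)).sum_comp]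
  rfl

/-- The inner product of two shifts of a product window factors over the coordinates. -/
theorem innerC_gabor_product {p : ℕ} [NeZero p] {f h : ZMod p → ℂ} {c : ℝ}
    (hh : ∀ x, ‖h x‖ = c) {g : (Fin 2 → ZMod p) → ℂ} (hg : ∀ x, g x = f (x 0) * h (x 1))
    (a b a' b' : ZMod p) :
    innerC (gabor g ![a, 0] ![0, b]) (gabor g ![a', 0] ![0, b']) =
      (∑ x, f (x + (a' - a)) * conj (f x)) *
        ((c : ℂ) ^ 2 * ∑ y : ZMod p, ZMod.stdAddChar (y * (b - b'))) := by
  have hshift : ∑ x, f (x + (a' - a)) * conj (f x) = ∑ x, f (x - a) * conj (f (x - a')) := by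
    rw [← (Equiv.subRight a').sum_comp]
    refine sum_congr rfl fun x _ => ?_
    simp
  rw [hshift, mul_sum, ← sum_fin_two_mul, innerC]
  refine sum_congr rfl fun x _ => ?_
  have hchar : (ZMod.stdAddChar (x 1 * (b - b')) : ℂ) =
      ZMod.stdAddChar (x 1 * b) * conj (ZMod.stdAddChar (x 1 * b')) := by
    rw [← AddChar.map_neg_eq_conj, ← AddChar.map_add_eq_mul]
    congr 1
    ring
  rw [hchar, ← hh (x 1), ← Complex.mul_conj']
  simp only [gabor, hg, dotp, Fin.sum_univ_two, chi_eq_stdAddChar, Pi.sub_apply,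
    Matrix.cons_val_zero, Matrix.cons_val_one, mul_zero, zero_add, sub_zero, map_mul]
  ring

/-- If `|f̂|` is constant, `|h| ≡ c > 0`, `g(x₁,x₂) = f(x₁)h(x₂)` has
`‖g‖₂ = 1`, `A = ℤ_p × {0}` and `B = {0} × ℤ_p`, then `𝒢(g, A, B)` is an orthonormal
basis of `L²(ℤ_p²)`. -/
theorem gabor_onb_of_product_window
    (p : ℕ) [Fact p.Prime]
    (f : ZMod p → ℂ) (hf : ∃ C : ℝ, ∀ m : ZMod p, ‖ft1 f m‖ = C)
    (h : ZMod p → ℂ) (c : ℝ) (hc : 0 < c) (hh : ∀ x : ZMod p, ‖h x‖ = c)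
    (g : (Fin 2 → ZMod p) → ℂ) (hgdef : ∀ x, g x = f (x 0) * h (x 1))
    (hg : ∑ x, ‖g x‖ ^ 2 = 1) :
    IsGaborONB g (Finset.univ.image (fun a : ZMod p => ![a, 0]))
      (Finset.univ.image (fun b : ZMod p => ![0, b])) := by
  obtain ⟨C, hC⟩ := hf
  have hA : Function.Injective fun a : ZMod p => ![a, 0] := fun a a' e => congrFun e 0
  have hB : Function.Injective fun b : ZMod p => ![0, b] := fun b b' e => congrFun e 1
  refine isGaborONB_of_orthonormal g _ _ ?_ ?_
  · rw [card_image_of_injective _ hA, card_image_of_injective _ hB, card_univ, ZMod.card, sq]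
  simp only [mem_image, mem_univ, true_and, forall_exists_index, forall_apply_eq_imp_iff]
  intro a b a' b'
  simp only [hA.eq_iff, hB.eq_iff]
  by_cases ha : a = a'
  · by_cases hb : b = b'
    · subst ha hb
      have hnorm : innerC (gabor g ![0, 0] ![0, 0]) (gabor g ![0, 0] ![0, 0]) = 1 := by
        have hzero : gabor g ![0, 0] ![0, 0] = g := by
          funext x
          simp [gabor, hgdef, dotp, chi, Matrix.vecHead, Matrix.vecTail]
        rw [hzero, innerC]
        simp only [Complex.mul_conj']
        exact_mod_cast hg
      rw [innerC_gabor_product hh hgdef] at hnorm ⊢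
      simpa using hnorm
    · rw [innerC_gabor_product hh hgdef,
        AddChar.sum_mulShift _ (ZMod.isPrimitive_stdAddChar p), if_neg (sub_ne_zero.2 hb)]
      simp [hb]
  · rw [innerC_gabor_product hh hgdef,
      sum_mul_conj_shift_eq_zero hC (sub_ne_zero.2 (Ne.symm ha))]
    simp [ha]
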